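/- There exists a universal constant C > 0 with the following property. Let μ be a log-concave probability measure on ℝⁿ, set M = ∫_{ℝⁿ} ‖x‖² dμ(x), and for R > 0 let μ_R denote μ conditioned on the closed ball of radius R centered at 0 (i.e. μ_R(A) = μ(A ∩ B(0,R))/μ(B(0,R))). Then for every R ≥ C√M, W₂²(μ, μ_R) ≤ C M exp(−R/(C√M)). -/

import Mathlib

open MeasureTheory ProbabilityTheory

/-- Squared 2-Wasserstein distance between two measures on `ℝⁿ`:
the infimum of `∫ ‖x - y‖²` over all couplings. -/
noncomputable def W2sq {n : ℕ}
    (μ ν : Measure (EuclideanSpace ℝ (Fin n))) : ℝ :=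
  sInf { c : ℝ | ∃ γ : Measure (EuclideanSpace ℝ (Fin n) × EuclideanSpace ℝ (Fin n)),
    γ.map Prod.fst = μ ∧ γ.map Prod.snd = ν ∧ c = ∫ p, ‖p.1 - p.2‖ ^ 2 ∂γ }

/-- A measure on `ℝⁿ` is log-concave if it has density `e^{-V} 1_S` with respect to the
Lebesgue measure, where `S` is a convex set and `V` is convex on `S`. -/
def IsLogConcaveMeasure {n : ℕ} (μ : Measure (EuclideanSpace ℝ (Fin n))) : Prop :=
  ∃ (S : Set (EuclideanSpace ℝ (Fin n))) (V : EuclideanSpace ℝ (Fin n) → ℝ),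
    Convex ℝ S ∧ ConvexOn ℝ S V ∧
    μ = volume.withDensity (S.indicator fun x => ENNReal.ofReal (Real.exp (-V x)))

/-- The measure `μ` conditioned on the closed ball of radius `R` centered at the origin. -/
noncomputable def condBall {n : ℕ} (μ : Measure (EuclideanSpace ℝ (Fin n))) (R : ℝ) :
    Measure (EuclideanSpace ℝ (Fin n)) :=
  (μ (Metric.closedBall 0 R))⁻¹ • μ.restrict (Metric.closedBall 0 R)


open scoped ENNReal

lemma bm1_compact {K L D : Set ℝ} (hK : IsCompact K) (hL : IsCompact L) (hK0 : K.Nonempty)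
    (hL0 : L.Nonempty) (h : ∀ a ∈ K, ∀ b ∈ L, (1/2:ℝ) • (a + b) ∈ D) :
    volume K + volume L ≤ 2 * volume D := by
  obtain ⟨k, hkK, hk⟩ := hK.exists_isGreatest hK0
  obtain ⟨l, hlL, hl⟩ := hL.exists_isLeast hL0
  have hD : volume ((fun x : ℝ => (1/2:ℝ) * x) ⁻¹' D) = 2 * volume D := by
    rw [Real.volume_preimage_mul_left (by norm_num)]
    congr 1
    norm_num
  have h1 : volume ((fun x : ℝ => x + (-l)) ⁻¹' K) = volume K := measure_preimage_add_right _ _ _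
  have h2 : volume ((fun x : ℝ => (-k) + x) ⁻¹' L) = volume L := measure_preimage_add _ _ _
  have hm : MeasurableSet ((fun x : ℝ => (-k) + x) ⁻¹' L) :=
    hL.measurableSet.preimage (by fun_prop)
  have hin : volume (((fun x : ℝ => x + (-l)) ⁻¹' K) ∩ ((fun x : ℝ => (-k) + x) ⁻¹' L)) = 0 := by
    refine measure_mono_null (t := {k + l}) ?_ (by simp)
    rintro x ⟨hx1, hx2⟩
    have := hk hx1
    have := hl hx2
    simp only [Set.mem_singleton_iff]
    linarith
  rw [← hD, ← h1, ← h2, ← measure_union_add_inter _ hm, hin, add_zero]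
  apply measure_mono
  rintro x (hx | hx)
  · have := h _ hx _ hlL
    simpa using this
  · have := h _ hkK _ hx
    simpa using this

lemma bm1 {A B D : Set ℝ} (hA : MeasurableSet A) (hB : MeasurableSet B) (hA0 : A.Nonempty)
    (hB0 : B.Nonempty) (h : ∀ a ∈ A, ∀ b ∈ B, (1/2:ℝ) • (a + b) ∈ D) :
    volume A + volume B ≤ 2 * volume D := by
  obtain ⟨a, ha⟩ := hA0
  obtain ⟨b, hb⟩ := hB0
  rw [hA.measure_eq_iSup_isCompact, hB.measure_eq_iSup_isCompact]
  simp only [iSup_and']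
  refine ENNReal.biSup_add_biSup_le' ⟨∅, by simp⟩ ⟨∅, by simp⟩ ?_
  rintro K ⟨hKA, hK⟩ L ⟨hLB, hL⟩
  have h1 : insert a K ⊆ A := Set.insert_subset ha hKA
  have h2 : insert b L ⊆ B := Set.insert_subset hb hLB
  refine le_trans (add_le_add (measure_mono (Set.subset_insert a K))
    (measure_mono (Set.subset_insert b L))) ?_
  exact bm1_compact (hK.insert a) (hL.insert b) (Set.insert_nonempty _ _) (Set.insert_nonempty _ _)
    fun x hx y hy => h x (h1 hx) y (h2 hy)

lemma pl1_core {f g h : ℝ → ℝ} (hf : Measurable f) (hg : Measurable g) (hh : Measurable h)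
    (f0 : ∀ x, 0 ≤ f x) (g0 : ∀ x, 0 ≤ g x) (h0 : ∀ x, 0 ≤ h x)
    (f1 : ∀ x, f x ≤ 1) (g1 : ∀ x, g x ≤ 1)
    (fs : ∀ t < 1, ∃ x, t < f x) (gs : ∀ t < 1, ∃ x, t < g x)
    (H : ∀ x y, f x * g y ≤ h ((1/2:ℝ) • (x + y)) ^ 2) :
    (∫⁻ x, ENNReal.ofReal (f x)) + (∫⁻ x, ENNReal.ofReal (g x))
      ≤ 2 * ∫⁻ x, ENNReal.ofReal (h x) := by
  rw [lintegral_eq_lintegral_meas_lt _ (.of_forall f0) hf.aemeasurable,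
    lintegral_eq_lintegral_meas_lt _ (.of_forall g0) hg.aemeasurable,
    lintegral_eq_lintegral_meas_lt _ (.of_forall h0) hh.aemeasurable,
    ← lintegral_const_mul' _ _ (by simp), ← lintegral_add_left']
  · apply lintegral_mono_ae
    filter_upwards [ae_restrict_mem measurableSet_Ioi] with t ht
    have ht : 0 < t := ht
    rcases lt_or_ge t 1 with h1 | h1
    · refine bm1 (measurableSet_lt measurable_const hf) (measurableSet_lt measurable_const hg)
        (fs t h1) (gs t h1) ?_
      intro a ha b hb
      have ha : t < f a := ha
      have hb : t < g b := hb
      show t < h _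
      have := H a b
      have h2 : t * t < f a * g b := by gcongr
      exact lt_of_pow_lt_pow_left₀ 2 (h0 _) (by nlinarith)
    · have e1 : {a | t < f a} = ∅ := by
        ext a; simp; exact (f1 a).trans h1
      have e2 : {a | t < g a} = ∅ := by
        ext a; simp; exact (g1 a).trans h1
      simp [e1, e2]
  · apply Measurable.aemeasurable
    apply Antitone.measurable
    intro s t hst
    exact measure_mono fun x hx => lt_of_le_of_lt hst hx

lemma pl1_real {f g h : ℝ → ℝ} (hf : Measurable f) (hg : Measurable g) (hh : Measurable h)
    (f0 : ∀ x, 0 ≤ f x) (g0 : ∀ x, 0 ≤ g x) (h0 : ∀ x, 0 ≤ h x)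
    {N : ℝ} (f1 : ∀ x, f x ≤ N) (g1 : ∀ x, g x ≤ N)
    (H : ∀ x y, f x * g y ≤ h ((1/2:ℝ) • (x + y)) ^ 2) :
    (∫⁻ x, ENNReal.ofReal (f x)) * (∫⁻ x, ENNReal.ofReal (g x))
      ≤ (∫⁻ x, ENNReal.ofReal (h x)) ^ 2 := by
  have bf : BddAbove (Set.range f) := ⟨N, by rintro _ ⟨x, rfl⟩; exact f1 x⟩
  have bg : BddAbove (Set.range g) := ⟨N, by rintro _ ⟨x, rfl⟩; exact g1 x⟩
  set a := ⨆ x, f x with ha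
  set b := ⨆ x, g x with hb
  have fa : ∀ x, f x ≤ a := fun x => le_ciSup bf x
  have gb : ∀ x, g x ≤ b := fun x => le_ciSup bg x
  rcases (le_trans (f0 0) (fa 0)).eq_or_lt with a0 | a0
  · have : ∀ x, f x = 0 := fun x => le_antisymm ((fa x).trans a0.symm.le) (f0 x)
    simp [this]
  rcases (le_trans (g0 0) (gb 0)).eq_or_lt with b0 | b0
  · have : ∀ x, g x = 0 := fun x => le_antisymm ((gb x).trans b0.symm.le) (g0 x)
    simp [this]
  set c := Real.sqrt (a * b) with hc
  have c0 : 0 < c := Real.sqrt_pos.2 (by positivity)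
  have c2 : c ^ 2 = a * b := Real.sq_sqrt (by positivity)
  have key := pl1_core (f := fun x => a⁻¹ * f x) (g := fun x => b⁻¹ * g x) (h := fun x => c⁻¹ * h x)
    (by fun_prop) (by fun_prop) (by fun_prop)
    (fun x => by have := f0 x; positivity) (fun x => by have := g0 x; positivity)
    (fun x => by have := h0 x; positivity)
    (fun x => by rw [inv_mul_le_iff₀ a0]; simpa using fa x)
    (fun x => by rw [inv_mul_le_iff₀ b0]; simpa using gb x)
    (fun t ht => by
      obtain ⟨x, hx⟩ := exists_lt_of_lt_ciSup (show a * t < ⨆ x, f x by nlinarith)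
      exact ⟨x, by rwa [lt_inv_mul_iff₀ a0]⟩)
    (fun t ht => by
      obtain ⟨x, hx⟩ := exists_lt_of_lt_ciSup (show b * t < ⨆ x, g x by nlinarith)
      exact ⟨x, by rwa [lt_inv_mul_iff₀ b0]⟩)
    (fun x y => by
      have e : a⁻¹ * f x * (b⁻¹ * g y) = (a * b)⁻¹ * (f x * g y) := by
        rw [mul_inv]; ring
      rw [e, mul_pow, inv_pow, c2]
      exact mul_le_mul_of_nonneg_left (H x y) (by positivity))
  simp only [ENNReal.ofReal_mul (inv_nonneg.2 a0.le), ENNReal.ofReal_mul (inv_nonneg.2 b0.le),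
    ENNReal.ofReal_mul (inv_nonneg.2 c0.le)] at key
  rw [lintegral_const_mul' _ _ (by simp), lintegral_const_mul' _ _ (by simp),
    lintegral_const_mul' _ _ (by simp)] at key
  generalize (∫⁻ x, ENNReal.ofReal (f x)) = F at *
  generalize (∫⁻ x, ENNReal.ofReal (g x)) = G at *
  generalize (∫⁻ x, ENNReal.ofReal (h x)) = I at *
  by_cases hI : I = ⊤
  · simp [hI]
  have hr : 2 * (ENNReal.ofReal c⁻¹ * I) ≠ ⊤ := by finiteness
  have hl := ne_top_of_le_ne_top hr key
  rw [ENNReal.add_ne_top] at hl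
  have hF : F ≠ ⊤ := by
    rintro rfl
    apply hl.1
    rw [ENNReal.mul_top]; simpa using a0
  have hG : G ≠ ⊤ := by
    rintro rfl
    apply hl.2
    rw [ENNReal.mul_top]; simpa using b0
  lift F to NNReal using hF
  lift G to NNReal using hG
  lift I to NNReal using hI
  have k2 := ENNReal.toReal_mono hr key
  rw [ENNReal.toReal_add hl.1 hl.2] at k2
  simp only [ENNReal.toReal_mul, ENNReal.coe_toReal, ENNReal.toReal_ofReal (inv_nonneg.2 a0.le),
    ENNReal.toReal_ofReal (inv_nonneg.2 b0.le), ENNReal.toReal_ofReal (inv_nonneg.2 c0.le),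
    ENNReal.toReal_ofNat] at k2
  norm_cast
  rw [← NNReal.coe_le_coe]
  push_cast
  have F0 : (0:ℝ) ≤ F := F.2
  have G0 : (0:ℝ) ≤ G := G.2
  have I0 : (0:ℝ) ≤ I := I.2
  set u := a⁻¹ * (F:ℝ)
  set v := b⁻¹ * (G:ℝ)
  set w := c⁻¹ * (I:ℝ)
  have eF : (F:ℝ) = a * u := by simp only [u]; field_simp
  have eG : (G:ℝ) = b * v := by simp only [v]; field_simp
  have eI : (I:ℝ) = c * w := by simp only [w]; field_simp
  have u0 : 0 ≤ u := by positivity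
  have v0 : 0 ≤ v := by positivity
  have w0 : 0 ≤ w := by positivity
  have huv : u * v ≤ w ^ 2 := by nlinarith [sq_nonneg (u - v)]
  rw [eF, eG, eI, mul_pow, c2]
  have hab : 0 ≤ a * b := by positivity
  calc a * u * (b * v) = (a * b) * (u * v) := by ring
    _ ≤ _ := mul_le_mul_of_nonneg_left huv hab

lemma pl1 {f g h : ℝ → ℝ≥0∞} (hf : Measurable f) (hg : Measurable g) (hh : Measurable h)
    (H : ∀ x y, f x * g y ≤ h ((1/2:ℝ) • (x + y)) ^ 2) :
    (∫⁻ x, f x) * (∫⁻ x, g x) ≤ (∫⁻ x, h x) ^ 2 := by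
  have key : ∀ N : ℕ, (∫⁻ x, min (f x) N) * (∫⁻ x, min (g x) N) ≤ (∫⁻ x, h x) ^ 2 := by
    intro N
    have hN : ∀ y : ℝ≥0∞, min y (N:ℝ≥0∞) ≠ ⊤ := fun y =>
      ne_top_of_le_ne_top (ENNReal.natCast_ne_top N) (min_le_right _ _)
    have := pl1_real (f := fun x => (min (f x) N).toReal) (g := fun x => (min (g x) N).toReal)
      (h := fun x => (min (h x) N).toReal) (N := N)
      (by fun_prop) (by fun_prop) (by fun_prop)
      (by simp) (by simp) (by simp)
      (fun x => by
        have := ENNReal.toReal_mono (ENNReal.natCast_ne_top N) (min_le_right (f x) (N:ℝ≥0∞))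
        simpa using this)
      (fun x => by
        have := ENNReal.toReal_mono (ENNReal.natCast_ne_top N) (min_le_right (g x) (N:ℝ≥0∞))
        simpa using this)
      (fun x y => by
        rw [← ENNReal.toReal_mul, ← ENNReal.toReal_pow]
        apply ENNReal.toReal_mono (by finiteness [hN (h ((1/2:ℝ) • (x + y)))])
        rcases le_total (h ((1/2:ℝ) • (x + y))) N with h1 | h1
        · rw [min_eq_left h1]
          exact (mul_le_mul' (min_le_left _ _) (min_le_left _ _)).trans (H x y)
        · rw [min_eq_right h1, sq]
          exact (mul_le_mul' (min_le_right _ _) (min_le_right _ _)))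
    simp only [ENNReal.ofReal_toReal (hN _)] at this
    refine this.trans ?_
    gcongr
    exact min_le_left _ _
  have sup : ∀ f : ℝ → ℝ≥0∞, Measurable f → ∫⁻ x, f x = ⨆ N : ℕ, ∫⁻ x, min (f x) N := by
    intro f hf
    rw [← lintegral_iSup (fun N => by fun_prop)
      (fun i j hij x => by simp only; gcongr)]
    congr with x
    rw [← inf_iSup_eq, ENNReal.iSup_natCast, inf_top_eq]
  rw [sup f hf, sup g hg, ENNReal.iSup_mul]
  refine iSup_le fun i => ?_
  rw [ENNReal.mul_iSup]
  refine iSup_le fun j => ?_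
  refine le_trans ?_ (key (max i j))
  gcongr
  · exact le_max_left _ _
  · exact le_max_right _ _

lemma piFin_symm_eq {n : ℕ} (p : ℝ × (Fin n → ℝ)) :
    (MeasurableEquiv.piFinSuccAbove (fun _ : Fin (n+1) => ℝ) 0).symm p
      = (Fin.cons p.1 p.2 : Fin (n+1) → ℝ) := by
  ext i
  refine Fin.cases ?_ (fun j => ?_) i <;> simp [MeasurableEquiv.piFinSuccAbove]

lemma lintegral_fin_succ {n : ℕ} {f : (Fin (n+1) → ℝ) → ℝ≥0∞} (hf : Measurable f) :
    ∫⁻ x, f x = ∫⁻ t : ℝ, ∫⁻ v : Fin n → ℝ, f (Fin.cons t v) := by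
  have e := (volume_preserving_piFinSuccAbove (fun _ : Fin (n+1) => ℝ) 0).symm
  rw [← e.lintegral_comp hf]
  show ∫⁻ a, _ ∂(volume.prod volume) = _
  rw [lintegral_prod]
  · simp only [piFin_symm_eq]
  · exact (hf.comp e.measurable).aemeasurable

lemma pln (n : ℕ) : ∀ {f g h : (Fin n → ℝ) → ℝ≥0∞}, Measurable f → Measurable g → Measurable h →
    (∀ x y, f x * g y ≤ h ((1/2:ℝ) • (x + y)) ^ 2) →
    (∫⁻ x, f x) * (∫⁻ x, g x) ≤ (∫⁻ x, h x) ^ 2 := by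
  induction n with
  | zero =>
    intro f g h hf hg hh H
    rw [lintegral_unique, lintegral_unique, lintegral_unique]
    have hu : (volume : Measure (Fin 0 → ℝ)) Set.univ = 1 := by
      rw [Measure.volume_pi_eq_dirac 0]; simp
    rw [hu]
    simp only [mul_one]
    convert H default default
  | succ n ih =>
    intro f g h hf hg hh H
    rw [lintegral_fin_succ hf, lintegral_fin_succ hg, lintegral_fin_succ hh]
    have hm : ∀ f : (Fin (n+1) → ℝ) → ℝ≥0∞, Measurable f →
        Measurable (fun p : ℝ × (Fin n → ℝ) => f (Fin.cons p.1 p.2)) := by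
      intro f hf
      have := hf.comp (MeasurableEquiv.piFinSuccAbove (fun _ : Fin (n+1) => ℝ) 0).symm.measurable
      simpa only [Function.comp_def, piFin_symm_eq] using this
    refine pl1 (hm f hf).lintegral_prod_right' (hm g hg).lintegral_prod_right'
      (hm h hh).lintegral_prod_right' ?_
    intro s t
    refine ih ((hm f hf).comp (measurable_prodMk_left (x := s))) ((hm g hg).comp (measurable_prodMk_left (x := t)))
      ((hm h hh).comp (measurable_prodMk_left (x := ((1/2:ℝ) • (s + t))))) ?_
    intro x y
    convert H (Fin.cons s x) (Fin.cons t y) using 3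
    ext i
    refine Fin.cases ?_ (fun j => ?_) i <;> simp [mul_add]

lemma plE (n : ℕ) {f g h : EuclideanSpace ℝ (Fin n) → ℝ≥0∞} (hf : Measurable f) (hg : Measurable g)
    (hh : Measurable h)
    (H : ∀ x y, f x * g y ≤ h ((1/2:ℝ) • (x + y)) ^ 2) :
    (∫⁻ x, f x) * (∫⁻ x, g x) ≤ (∫⁻ x, h x) ^ 2 := by
  have e := PiLp.volume_preserving_toLp (Fin n)
  rw [← e.lintegral_comp hf, ← e.lintegral_comp hg, ← e.lintegral_comp hh]
  refine pln n (hf.comp e.measurable) (hg.comp e.measurable) (hh.comp e.measurable) ?_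
  intro x y
  simpa using H (WithLp.toLp 2 x) (WithLp.toLp 2 y)
open scoped ENNReal

lemma exists_density {n : ℕ} {μ : Measure (EuclideanSpace ℝ (Fin n))} (hμ : IsLogConcaveMeasure μ) :
    ∃ ρ : EuclideanSpace ℝ (Fin n) → ℝ≥0∞, Measurable ρ ∧ μ = volume.withDensity ρ ∧
      ∀ x y, ρ x * ρ y ≤ ρ ((1/2:ℝ) • (x + y)) ^ 2 := by
  obtain ⟨S, V, hS, hV, rfl⟩ := hμ
  refine ⟨(interior S).indicator fun x => ENNReal.ofReal (Real.exp (-V x)), ?_, ?_, ?_⟩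
  · have hc : ContinuousOn (fun x => ENNReal.ofReal (Real.exp (-V x))) (interior S) :=
      ENNReal.continuous_ofReal.comp_continuousOn
        (Real.continuous_exp.comp_continuousOn hV.continuousOn_interior.neg)
    classical
    have := hc.measurable_piecewise (g := 0) continuousOn_const
      isOpen_interior.measurableSet
    rwa [Set.piecewise_eq_indicator] at this
  · apply withDensity_congr_ae
    have h0 : volume (frontier S) = 0 := hS.addHaar_frontier _
    have : ∀ᵐ x ∂(volume : Measure (EuclideanSpace ℝ (Fin n))), x ∉ frontier S :=
      measure_eq_zero_iff_ae_notMem.1 h0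
    filter_upwards [this] with x hx
    by_cases h1 : x ∈ interior S
    · rw [Set.indicator_of_mem h1, Set.indicator_of_mem (interior_subset h1)]
    · rw [Set.indicator_of_notMem h1, Set.indicator_of_notMem]
      intro h2
      exact hx ⟨subset_closure h2, h1⟩
  · intro x y
    by_cases hx : x ∈ interior S
    · by_cases hy : y ∈ interior S
      · have hm : (1/2:ℝ) • (x + y) ∈ interior S := by
          rw [smul_add]
          exact hS.interior hx hy (by norm_num) (by norm_num) (by norm_num)
        rw [Set.indicator_of_mem hx, Set.indicator_of_mem hy, Set.indicator_of_mem hm,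
          ← ENNReal.ofReal_mul (Real.exp_pos _).le, ← ENNReal.ofReal_pow (Real.exp_pos _).le,
          ← Real.exp_add, ← Real.exp_nat_mul]
        apply ENNReal.ofReal_le_ofReal
        apply Real.exp_le_exp.2
        have := hV.2 (interior_subset hx) (interior_subset hy) 
          (show (0:ℝ) ≤ 1/2 by norm_num) (show (0:ℝ) ≤ 1/2 by norm_num) (by norm_num)
        rw [← smul_add] at this
        simp only [smul_eq_mul] at this
        push_cast
        linarith
      · rw [Set.indicator_of_notMem hy]; simp
    · rw [Set.indicator_of_notMem hx]; simp

lemma meas_norm_gt {n : ℕ} (s : ℝ) : MeasurableSet {x : EuclideanSpace ℝ (Fin n) | s < ‖x‖} :=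
  measurableSet_lt measurable_const measurable_norm

lemma borell_step {n : ℕ} {μ : Measure (EuclideanSpace ℝ (Fin n))} (hμ : IsLogConcaveMeasure μ)
    (r s : ℝ) :
    μ {x | 2 * s + r < ‖x‖} * μ (Metric.closedBall 0 r) ≤ μ {x | s < ‖x‖} ^ 2 := by
  obtain ⟨ρ, hρ, rfl, H⟩ := exists_density hμ
  have hb : MeasurableSet (Metric.closedBall (0 : EuclideanSpace ℝ (Fin n)) r) :=
    Metric.isClosed_closedBall.measurableSet
  rw [withDensity_apply _ (meas_norm_gt _), withDensity_apply _ (meas_norm_gt _),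
    withDensity_apply _ hb, ← lintegral_indicator (meas_norm_gt _),
    ← lintegral_indicator (meas_norm_gt _), ← lintegral_indicator hb]
  refine plE n (hρ.indicator (meas_norm_gt _)) (hρ.indicator hb) (hρ.indicator (meas_norm_gt _)) ?_
  intro x y
  by_cases hx : 2 * s + r < ‖x‖
  · by_cases hy : y ∈ Metric.closedBall (0 : EuclideanSpace ℝ (Fin n)) r
    · have hm : (1/2:ℝ) • (x + y) ∈ {x : EuclideanSpace ℝ (Fin n) | s < ‖x‖} := by
        have hy' : ‖y‖ ≤ r := by simpa using hy
        have h1 : ‖x‖ ≤ ‖x + y‖ + ‖y‖ := by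
          have := norm_sub_le (x + y) y
          simpa using this
        simp only [Set.mem_ofPred_eq, norm_smul]
        norm_num
        linarith
      rw [Set.indicator_of_mem hm, Set.indicator_of_mem hy, Set.indicator_of_mem (by exact hx)]
      exact H x y
    · rw [Set.indicator_of_notMem hy]; simp
  · rw [Set.indicator_of_notMem (by exact hx)]; simp

lemma tail_bound {n : ℕ} {μ : Measure (EuclideanSpace ℝ (Fin n))} [IsProbabilityMeasure μ]
    (hμ : IsLogConcaveMeasure μ) {r : ℝ} (hr : 0 < r) (h9 : μ.real {x | r < ‖x‖} ≤ 1/9)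
    {s : ℝ} (hs : r ≤ s) : μ.real {x | s < ‖x‖} ≤ Real.exp (-s / (2 * r)) := by
  have hball : 8/9 ≤ μ.real (Metric.closedBall 0 r) := by
    have : (Metric.closedBall (0 : EuclideanSpace ℝ (Fin n)) r) = {x | r < ‖x‖}ᶜ := by
      ext x; simp
    rw [this, probReal_compl_eq_one_sub (meas_norm_gt _)]
    linarith
  have step : ∀ s, (9/8) * μ.real {x | 2 * s + r < ‖x‖} ≤ ((9/8) * μ.real {x | s < ‖x‖}) ^ 2 := by
    intro s
    have h1 := ENNReal.toReal_mono (by finiteness) (borell_step hμ r s)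
    rw [ENNReal.toReal_mul, ENNReal.toReal_pow] at h1
    change μ.real _ * μ.real _ ≤ (μ.real _) ^ 2 at h1
    have h0 : 0 ≤ μ.real {x | 2 * s + r < ‖x‖} := measureReal_nonneg
    nlinarith
  have iter : ∀ k : ℕ, (9/8) * μ.real {x | 2 ^ k * (2 * r) - r < ‖x‖} ≤ (1/8) ^ (2 ^ k) := by
    intro k
    induction k with
    | zero =>
      have : (2:ℝ) ^ 0 * (2 * r) - r = r := by ring
      rw [this]; norm_num; linarith
    | succ k ih =>
      have e : (2:ℝ) ^ (k+1) * (2 * r) - r = 2 * (2 ^ k * (2 * r) - r) + r := by ring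
      rw [e]
      refine (step _).trans ?_
      rw [pow_succ 2 k, pow_mul]
      gcongr
  obtain ⟨k, hk1, hk2⟩ := exists_nat_pow_near (x := (s + r) / (2 * r)) (y := 2)
    (by rw [le_div_iff₀ (by positivity)]; linarith) (by norm_num)
  rw [le_div_iff₀ (by positivity)] at hk1
  have hmono : μ.real {x | s < ‖x‖} ≤ μ.real {x | 2 ^ k * (2 * r) - r < ‖x‖} := by
    refine measureReal_mono ?_ (measure_ne_top _ _)
    intro x (hx : s < ‖x‖)
    show 2 ^ k * (2 * r) - r < ‖x‖
    linarith
  have h0 : 0 ≤ μ.real {x | s < ‖x‖} := measureReal_nonneg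
  have e8 : (1/8 : ℝ) ≤ Real.exp (-2) := by
    rw [Real.exp_neg, one_div]
    apply inv_anti₀ (Real.exp_pos _)
    have := Real.exp_one_lt_d9
    have e2 : Real.exp 2 = Real.exp 1 ^ 2 := by rw [← Real.exp_nat_mul]; norm_num
    rw [e2]
    nlinarith [Real.exp_pos 1]
  calc μ.real {x | s < ‖x‖} ≤ (1/8) ^ (2 ^ k) := by linarith [iter k]
    _ ≤ (Real.exp (-2)) ^ (2 ^ k) := by gcongr
    _ = Real.exp (- 2 ^ (k+1)) := by rw [← Real.exp_nat_mul]; push_cast; ring_nf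
    _ ≤ _ := by
      apply Real.exp_le_exp.2
      have : s / (2 * r) ≤ (s + r) / (2 * r) := by gcongr; linarith
      rw [neg_div]
      linarith

lemma tail_integral {n : ℕ} {μ : Measure (EuclideanSpace ℝ (Fin n))} [IsProbabilityMeasure μ]
    (hμ : IsLogConcaveMeasure μ) {r : ℝ} (hr : 0 < r) (h9 : μ.real {x | r < ‖x‖} ≤ 1/9)
    {R : ℝ} (hR : r ≤ R) : ∫⁻ x in {x | R < ‖x‖}, ENNReal.ofReal (‖x‖ ^ 2) ∂μ
      ≤ ENNReal.ofReal (320 * r ^ 2 * Real.exp (-R / (4 * r))) := by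
  let c : ℕ → ℝ := fun k => 32 * r ^ 2 * Real.exp ((R + (k+1) * r) / (4 * r))
  let A : ℕ → Set (EuclideanSpace ℝ (Fin n)) := fun k => {x | R + k * r < ‖x‖}
  have hc : ∀ k, 0 ≤ c k := fun k => by positivity
  rw [← lintegral_indicator (meas_norm_gt _)]
  have pt : ∀ x, ({x | R < ‖x‖} : Set (EuclideanSpace ℝ (Fin n))).indicator
      (fun x => ENNReal.ofReal (‖x‖ ^ 2)) x
      ≤ ∑' k, (A k).indicator (fun _ => ENNReal.ofReal (c k)) x := by
    intro x
    by_cases hx : R < ‖x‖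
    · rw [Set.indicator_of_mem (by exact hx)]
      have hp : 0 < (‖x‖ - R) / r := by apply div_pos <;> linarith
      set m := ⌈(‖x‖ - R) / r⌉₊ with hm
      have hm0 : 0 < m := Nat.ceil_pos.2 hp
      obtain ⟨k, hk⟩ : ∃ k, m = k + 1 := ⟨m - 1, by omega⟩
      have hk1 : (‖x‖ - R) / r ≤ k + 1 := by
        have := Nat.le_ceil ((‖x‖ - R) / r)
        rw [← hm, hk] at this
        exact_mod_cast this
      have hk2 : (k:ℝ) < (‖x‖ - R) / r := Nat.lt_ceil.1 (by omega)
      rw [div_le_iff₀ hr] at hk1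
      rw [lt_div_iff₀ hr] at hk2
      refine le_trans ?_ (ENNReal.le_tsum k)
      rw [Set.indicator_of_mem (show x ∈ A k from (by linarith : R + k * r < ‖x‖))]
      apply ENNReal.ofReal_le_ofReal
      have h1 : ‖x‖ ^ 2 ≤ 32 * r ^ 2 * Real.exp (‖x‖ / (4 * r)) := by
        have h2 := Real.quadratic_le_exp_of_nonneg (x := ‖x‖ / (4 * r)) (by positivity)
        have h3 : 0 ≤ ‖x‖ / (4 * r) := by positivity
        have h4 : ‖x‖ ^ 2 = 32 * r ^ 2 * ((‖x‖ / (4 * r)) ^ 2 / 2) := by field_simp; ring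
        rw [h4]
        gcongr
        linarith
      refine h1.trans ?_
      simp only [c]
      gcongr
      linarith
    · rw [Set.indicator_of_notMem (by exact hx)]; simp
  refine (lintegral_mono pt).trans ?_
  rw [lintegral_tsum (fun k => (measurable_const.indicator (meas_norm_gt _)).aemeasurable)]
  have term : ∀ k : ℕ, ∫⁻ x, (A k).indicator (fun _ => ENNReal.ofReal (c k)) x ∂μ
      ≤ ENNReal.ofReal (64 * r ^ 2 * Real.exp (-R / (4 * r)) * (4/5) ^ k) := by
    intro k
    rw [lintegral_indicator_const (meas_norm_gt _), ← ofReal_measureReal,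
      ← ENNReal.ofReal_mul (hc k)]
    apply ENNReal.ofReal_le_ofReal
    have kr : 0 ≤ (k:ℝ) * r := by positivity
    have ht := tail_bound hμ hr h9 (s := R + k * r) (by linarith)
    have q : Real.exp (-(1/4)) ≤ 4/5 := by
      rw [Real.exp_neg]
      have := Real.add_one_le_exp (1/4 : ℝ)
      rw [inv_le_comm₀ (Real.exp_pos _) (by norm_num)]
      linarith
    have q2 : Real.exp (1/4) ≤ 2 := by
      have h1 : Real.exp (-(1/4)) = (Real.exp (1/4))⁻¹ := Real.exp_neg _
      have h2 := Real.add_one_le_exp (-(1/4) : ℝ)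
      rw [h1] at h2
      have h3 := inv_anti₀ (by norm_num) h2
      rw [inv_inv] at h3
      linarith
    calc c k * μ.real (A k) ≤ c k * Real.exp (-(R + k * r) / (2 * r)) :=
          mul_le_mul_of_nonneg_left ht (hc k)
      _ = 32 * r ^ 2 * Real.exp (1/4) * Real.exp (-R / (4 * r)) * Real.exp (-(1/4)) ^ k := by
          simp only [c]
          rw [← Real.exp_nat_mul]
          simp only [mul_assoc, ← Real.exp_add]
          congr 3
          field_simp
          ring
      _ ≤ 32 * r ^ 2 * 2 * Real.exp (-R / (4 * r)) * (4/5) ^ k := by gcongr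
      _ = _ := by ring
  refine (ENNReal.tsum_le_tsum term).trans ?_
  have hsum := (hasSum_geometric_of_lt_one (r := (4/5:ℝ)) (by norm_num) (by norm_num)).mul_left
    (64 * r ^ 2 * Real.exp (-R / (4 * r)))
  rw [← ENNReal.ofReal_tsum_of_nonneg (fun k => by positivity) hsum.summable, hsum.tsum_eq]
  apply ENNReal.ofReal_le_ofReal
  apply le_of_eq
  ring

lemma coupling_bound {n : ℕ} {μ : Measure (EuclideanSpace ℝ (Fin n))} [IsProbabilityMeasure μ]
    {R B : ℝ} (hR : 0 ≤ R) (hB : 0 ≤ B) (h0 : μ (Metric.closedBall 0 R) ≠ 0)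
    (hI : ∫⁻ x in {x | R < ‖x‖}, ENNReal.ofReal (‖x‖ ^ 2) ∂μ ≤ ENNReal.ofReal B) :
    W2sq μ (condBall μ R) ≤ 4 * B := by
  set A := Metric.closedBall (0 : EuclideanSpace ℝ (Fin n)) R with hA
  have mA : MeasurableSet A := Metric.isClosed_closedBall.measurableSet
  have hAc : Aᶜ = {x | R < ‖x‖} := by ext x; simp [hA]
  have hν : IsProbabilityMeasure (condBall μ R) := by
    constructor
    simp only [condBall, Measure.smul_apply, Measure.restrict_apply_univ, smul_eq_mul]
    exact ENNReal.inv_mul_cancel h0 (measure_ne_top _ _)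
  have hνA : ∀ᵐ y ∂(condBall μ R), y ∈ A :=
    Measure.ae_smul_measure (ae_restrict_mem mA) _
  have hdiag : Measurable (fun x : EuclideanSpace ℝ (Fin n) => (x, x)) := by fun_prop
  set γ := (μ.restrict A).map (fun x => (x, x)) + (μ.restrict Aᶜ).prod (condBall μ R) with hγ
  have m1 : γ.map Prod.fst = μ := by
    rw [hγ, Measure.map_add _ _ measurable_fst, Measure.map_map measurable_fst hdiag,
      Measure.map_fst_prod]
    simp only [Function.comp_def, Measure.map_id', measure_univ, one_smul]
    exact Measure.restrict_add_restrict_compl mA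
  have m2 : γ.map Prod.snd = condBall μ R := by
    rw [hγ, Measure.map_add _ _ measurable_snd, Measure.map_map measurable_snd hdiag,
      Measure.map_snd_prod]
    simp only [Function.comp_def, Measure.map_id', Measure.restrict_apply_univ]
    have e : μ.restrict A = μ A • condBall μ R := by
      simp only [condBall, smul_smul, ← hA]
      rw [ENNReal.mul_inv_cancel h0 (measure_ne_top _ _), one_smul]
    rw [e, ← add_smul, measure_add_measure_compl mA, measure_univ, one_smul]
  have hle : W2sq μ (condBall μ R) ≤ ∫ p, ‖p.1 - p.2‖ ^ 2 ∂γ := by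
    apply csInf_le
    · refine ⟨0, ?_⟩
      rintro c ⟨γ', -, -, rfl⟩
      exact integral_nonneg fun p => by positivity
    · exact ⟨γ, m1, m2, rfl⟩
  refine hle.trans ?_
  rw [integral_eq_lintegral_of_nonneg_ae (.of_forall fun p => by positivity)
    (by fun_prop)]
  apply ENNReal.toReal_le_of_le_ofReal (by positivity)
  rw [hγ, lintegral_add_measure, lintegral_map (by fun_prop) hdiag]
  simp only [sub_self, norm_zero]
  rw [lintegral_prod _ (by fun_prop)]
  have hb : ∀ x ∈ Aᶜ, ∫⁻ y, ENNReal.ofReal (‖x - y‖ ^ 2) ∂(condBall μ R)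
      ≤ 4 * ENNReal.ofReal (‖x‖ ^ 2) := by
    intro x hx
    rw [hAc] at hx
    have hx : R < ‖x‖ := hx
    calc _ ≤ ∫⁻ y, 4 * ENNReal.ofReal (‖x‖ ^ 2) ∂(condBall μ R) := by
          apply lintegral_mono_ae
          filter_upwards [hνA] with y hy
          have hy : ‖y‖ ≤ R := by simpa [hA] using hy
          have : (4:ℝ≥0∞) = ENNReal.ofReal 4 := by simp
          rw [this, ← ENNReal.ofReal_mul (by norm_num)]
          apply ENNReal.ofReal_le_ofReal
          have h1 : ‖x - y‖ ≤ 2 * ‖x‖ := (norm_sub_le x y).trans (by linarith)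
          calc ‖x - y‖ ^ 2 ≤ (2 * ‖x‖) ^ 2 := by gcongr
            _ = _ := by ring
      _ = _ := by simp
  calc _ ≤ 0 + ∫⁻ x in Aᶜ, 4 * ENNReal.ofReal (‖x‖ ^ 2) ∂μ := by
        apply add_le_add
        · simp
        · exact setLIntegral_mono' mA.compl hb
    _ ≤ ENNReal.ofReal (4 * B) := by
        rw [zero_add, lintegral_const_mul' _ _ (by simp), ENNReal.ofReal_mul (by norm_num), hAc]
        have : (4:ℝ≥0∞) = ENNReal.ofReal 4 := by simp
        rw [← this]
        gcongr

lemma sq_integrable {n : ℕ} {μ : Measure (EuclideanSpace ℝ (Fin n))} [IsProbabilityMeasure μ]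
    (hμ : IsLogConcaveMeasure μ) : Integrable (fun x => ‖x‖ ^ 2) μ := by
  obtain ⟨r, hr, h9⟩ : ∃ r : ℝ, 0 < r ∧ μ.real {x | r < ‖x‖} ≤ 1/9 := by
    have ht : Filter.Tendsto (fun k : ℕ => μ {x | (k:ℝ) < ‖x‖}) Filter.atTop
        (nhds (μ (⋂ k : ℕ, {x | (k:ℝ) < ‖x‖}))) := by
      apply tendsto_measure_iInter_atTop
      · exact fun k => (meas_norm_gt _).nullMeasurableSet
      · intro i j hij x (hx : (j:ℝ) < ‖x‖)
        show (i:ℝ) < ‖x‖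
        exact lt_of_le_of_lt (by exact_mod_cast hij) hx
      · exact ⟨0, measure_ne_top _ _⟩
    have he : (⋂ k : ℕ, {x : EuclideanSpace ℝ (Fin n) | (k:ℝ) < ‖x‖}) = ∅ := by
      ext x
      simp only [Set.mem_iInter, Set.mem_ofPred_eq, Set.mem_empty_iff_false, iff_false, not_forall,
        not_lt]
      exact exists_nat_ge ‖x‖
    rw [he, measure_empty] at ht
    have h1 := ht.eventually (gt_mem_nhds (show (0:ℝ≥0∞) < ENNReal.ofReal (1/9) by simp))
    obtain ⟨k, hk, hk0⟩ := (h1.and (Filter.eventually_gt_atTop 0)).exists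
    exact ⟨k, by exact_mod_cast hk0, ENNReal.toReal_le_of_le_ofReal (by norm_num) hk.le⟩
  have ht := tail_integral hμ hr h9 le_rfl
  refine ⟨by fun_prop, ?_⟩
  rw [hasFiniteIntegral_iff_ofReal (.of_forall fun x => by positivity),
    ← lintegral_add_compl _ (meas_norm_gt r)]
  refine ENNReal.add_lt_top.2 ⟨lt_of_le_of_lt ht ENNReal.ofReal_lt_top, ?_⟩
  calc _ ≤ ∫⁻ x in {x | r < ‖x‖}ᶜ, ENNReal.ofReal (r ^ 2) ∂μ := by
        apply setLIntegral_mono' (meas_norm_gt r).compl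
        intro x hx
        have hx : ‖x‖ ≤ r := by simpa using hx
        gcongr
    _ < ⊤ := by simp; finiteness

lemma second_moment_pos {n : ℕ} (hn : 1 ≤ n) {μ : Measure (EuclideanSpace ℝ (Fin n))} [IsProbabilityMeasure μ]
    (hμ : IsLogConcaveMeasure μ) : 0 < ∫ x, ‖x‖ ^ 2 ∂μ := by
  have hi := sq_integrable hμ
  rcases (integral_nonneg (μ := μ) (f := fun x => ‖x‖ ^ 2) fun x => by positivity).eq_or_lt
    with h | h
  · exfalso
    have h1 := (integral_eq_zero_iff_of_nonneg (fun x => by positivity) hi).1 h.symm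
    have : Nonempty (Fin n) := ⟨⟨0, hn⟩⟩
    obtain ⟨S, V, -, -, e⟩ := hμ
    have hac : μ ≪ volume := e ▸ withDensity_absolutelyContinuous _ _
    have h0 : μ {0} = 0 := hac (by simp)
    have h2 : ∀ᵐ x ∂μ, x ∉ ({0} : Set _) := measure_eq_zero_iff_ae_notMem.1 h0
    have h3 : ∀ᵐ x ∂μ, False := by
      filter_upwards [h1, h2] with x hx hx'
      apply hx'
      simpa using hx
    rw [Filter.eventually_false_iff_eq_bot, ae_eq_bot] at h3
    exact IsProbabilityMeasure.ne_zero μ h3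
  · exact h

theorem w2sq_condBall_le :
    ∃ C : ℝ, 0 < C ∧
      ∀ (n : ℕ), 1 ≤ n →
        ∀ μ : Measure (EuclideanSpace ℝ (Fin n)), IsProbabilityMeasure μ →
          IsLogConcaveMeasure μ →
          ∀ M : ℝ, M = ∫ x, ‖x‖ ^ 2 ∂μ →
            ∀ R : ℝ, C * Real.sqrt M ≤ R →
              W2sq μ (condBall μ R) ≤ C * M * Real.exp (-R / (C * Real.sqrt M)) := by
  refine ⟨11520, by norm_num, ?_⟩
  intro n hn μ _ hμ M hM R hR
  have hi := sq_integrable hμ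
  have M0 : 0 < M := hM ▸ second_moment_pos hn hμ
  have s0 : 0 < Real.sqrt M := Real.sqrt_pos.2 M0
  have s2 : Real.sqrt M ^ 2 = M := Real.sq_sqrt M0.le
  set r := 3 * Real.sqrt M with hr
  have r0 : 0 < r := by positivity
  have r2 : r ^ 2 = 9 * M := by rw [hr, mul_pow, s2]; norm_num
  have hrR : r ≤ R := by linarith
  have h9 : μ.real {x | r < ‖x‖} ≤ 1/9 := by
    have hmk := mul_meas_ge_le_integral_of_nonneg (μ := μ) (f := fun x => ‖x‖ ^ 2)
      (.of_forall fun x => by positivity) hi (9 * M)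
    rw [← hM] at hmk
    have hmono : μ.real {x | r < ‖x‖} ≤ μ.real {x | 9 * M ≤ ‖x‖ ^ 2} := by
      refine measureReal_mono ?_ (measure_ne_top _ _)
      intro x (hx : r < ‖x‖)
      show 9 * M ≤ ‖x‖ ^ 2
      rw [← r2]
      gcongr
    have : (9 * M) * μ.real {x | r < ‖x‖} ≤ (9 * M) * (1/9) := by
      calc _ ≤ (9 * M) * μ.real {x | 9 * M ≤ ‖x‖ ^ 2} := by gcongr
        _ ≤ M := hmk
        _ = _ := by ring
    exact le_of_mul_le_mul_left this (by positivity)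
  have hb0 : μ (Metric.closedBall 0 R) ≠ 0 := by
    intro h0
    have h1 : μ {x | r < ‖x‖} = 1 := by
      have h2 : μ (Metric.closedBall 0 r) = 0 :=
        measure_mono_null (Metric.closedBall_subset_closedBall hrR) h0
      have h3 : {x : EuclideanSpace ℝ (Fin n) | r < ‖x‖} = (Metric.closedBall 0 r)ᶜ := by
        ext x; simp
      rw [h3, prob_compl_eq_one_iff Metric.isClosed_closedBall.measurableSet]
      exact h2
    rw [measureReal_def, h1] at h9
    norm_num at h9
  have ht := tail_integral hμ r0 h9 hrR
  have hR0 : 0 ≤ R := r0.le.trans hrR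
  refine (coupling_bound hR0 (by positivity) hb0 ht).trans ?_
  rw [r2]
  have he : Real.exp (-R / (4 * r)) ≤ Real.exp (-R / (11520 * Real.sqrt M)) := by
    apply Real.exp_le_exp.2
    rw [neg_div, neg_div, neg_le_neg_iff]
    apply div_le_div_of_nonneg_left hR0 (by positivity)
    rw [hr]; linarith
  calc 4 * (320 * (9 * M) * Real.exp (-R / (4 * r))) = 11520 * M * Real.exp (-R / (4 * r)) := by ring
    _ ≤ _ := by gcongr
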